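/- arXiv:1611.05595 — 3 statements merged into one kernel-verified Lean document; each statement's English description precedes it below -/
import Mathlib

section
/- For every integer k ≥ 1, the kernel of the 𝔽₂-linear map T_k has dimension 3^k − 2k − 1 over 𝔽₂ (equivalently, T_k has rank 2k + 1). -/
open Finset

noncomputable section

/-- The `𝔽₂`-linear map `T_k` sending `x : (Fin k → Fin 3) → 𝔽₂` to the function
`(i, j) ↦ Σ_{u : u i = j} x u`. -/
def Tk (k : ℕ) : ((Fin k → Fin 3) → ZMod 2) →ₗ[ZMod 2] (Fin k × Fin 3 → ZMod 2) where
  toFun x := fun p =>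
    ∑ u ∈ Finset.univ.filter fun u : Fin k → Fin 3 => u p.1 = p.2, x u
  map_add' x y := by
    funext p
    simp [Finset.sum_add_distrib]
  map_smul' c x := by
    funext p
    simp [Finset.mul_sum]

theorem Tk_apply (k : ℕ) (x : (Fin k → Fin 3) → ZMod 2) (i : Fin k) (j : Fin 3) :
    Tk k x (i, j) = ∑ u ∈ Finset.univ.filter fun u : Fin k → Fin 3 => u i = j, x u := rfl

/-- The total sum of `x` together with the entries of `Tk k x` at nonzero second index. -/
def reducedTk (k : ℕ) :
    ((Fin k → Fin 3) → ZMod 2) →ₗ[ZMod 2] (Option (Fin k × Fin 2) → ZMod 2) :=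
  LinearMap.pi fun o =>
    o.elim (∑ u, LinearMap.proj u) fun p => LinearMap.proj (p.1, p.2.succ) ∘ₗ Tk k

theorem reducedTk_none (k : ℕ) (x : (Fin k → Fin 3) → ZMod 2) :
    reducedTk k x none = ∑ u, x u := by
  simp [reducedTk]

theorem reducedTk_some (k : ℕ) (x : (Fin k → Fin 3) → ZMod 2) (p : Fin k × Fin 2) :
    reducedTk k x (some p) = Tk k x (p.1, p.2.succ) := by
  simp [reducedTk]

theorem sum_Tk_apply (k : ℕ) (x : (Fin k → Fin 3) → ZMod 2) (i : Fin k) :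
    ∑ j, Tk k x (i, j) = ∑ u, x u := by
  simp only [Tk_apply]
  exact Finset.sum_fiberwise _ _ _

theorem ker_reducedTk (k : ℕ) (hk : 1 ≤ k) :
    LinearMap.ker (reducedTk k) = LinearMap.ker (Tk k) := by
  ext x
  simp only [LinearMap.mem_ker]
  constructor
  · intro h
    have hs (i : Fin k) (j : Fin 2) : Tk k x (i, j.succ) = 0 := by
      rw [← reducedTk_some k x (i, j), h, Pi.zero_apply]
    funext ⟨i, j⟩
    refine Fin.cases ?_ (hs i) j
    have ht := sum_Tk_apply k x i
    rw [← reducedTk_none, h, Fin.sum_univ_succ] at ht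
    simpa [hs] using ht
  · intro h
    funext o
    cases o with
    | none =>
      rw [reducedTk_none, ← sum_Tk_apply k x ⟨0, hk⟩, h]
      simp
    | some p =>
      rw [reducedTk_some, h]
      rfl

theorem Tk_single (k : ℕ) (v : Fin k → Fin 3) (i : Fin k) (j : Fin 3) :
    Tk k (Pi.single v 1) (i, j) = if v i = j then 1 else 0 := by
  simp [Tk_apply]

theorem reducedTk_single_zero (k : ℕ) :
    reducedTk k (Pi.single 0 1) = Pi.single none 1 := by
  funext o
  cases o with
  | none => simp [reducedTk_none]
  | some p => simp [reducedTk_some, Tk_single, (Fin.succ_ne_zero p.2).symm]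

theorem reducedTk_single_single (k : ℕ) (p : Fin k × Fin 2) :
    reducedTk k (Pi.single (Pi.single p.1 p.2.succ) 1) =
      Pi.single none 1 + Pi.single (some p) 1 := by
  funext o
  cases o with
  | none => simp [reducedTk_none]
  | some q =>
    obtain ⟨i, j⟩ := p
    obtain ⟨i', j'⟩ := q
    by_cases hi : i' = i
    · subst hi
      simp [reducedTk_some, Tk_single, Pi.single_apply, eq_comm]
    · simp [reducedTk_some, Tk_single, hi, (Fin.succ_ne_zero j').symm]

theorem range_reducedTk (k : ℕ) : LinearMap.range (reducedTk k) = ⊤ := by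
  rw [eq_top_iff, ← (Pi.basisFun (ZMod 2) (Option (Fin k × Fin 2))).span_eq, Submodule.span_le]
  rintro _ ⟨o, rfl⟩
  rw [Pi.basisFun_apply]
  cases o with
  | none => exact ⟨_, reducedTk_single_zero k⟩
  | some p =>
    refine ⟨Pi.single (Pi.single p.1 p.2.succ) 1 - Pi.single 0 1, ?_⟩
    rw [map_sub, reducedTk_single_single, reducedTk_single_zero, add_sub_cancel_left]

theorem finrank_ker_Tk (k : ℕ) (hk : 1 ≤ k) :
    Module.finrank (ZMod 2) (LinearMap.ker (Tk k)) = 3 ^ k - 2 * k - 1 := by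
  have h := LinearMap.finrank_range_add_finrank_ker (reducedTk k)
  rw [range_reducedTk, finrank_top, ker_reducedTk k hk] at h
  simp at h
  omega
end
end

section
/- For every integer k ≥ 1, Σ_{s ∈ {A,B}^k} γ(U_s) = 2^{k + d}, where d is the dimension over 𝔽₂ of the kernel of the linear map T_k. -/
open Finset

open scoped Classical

noncomputable section

/-- `A = {1,3,5}` and `B = {0,2,4}` as subsets of `Fin 6`; a type `s : Fin k → Bool`
assigns to each coordinate one of the two sets (`true ↦ B`, `false ↦ A`). -/
def typeSet (b : Bool) : Finset (Fin 6) := if b then {0, 2, 4} else {1, 3, 5}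

/-- The largest maximal unlinked set `U_s = {u : u i ∈ s i for all i}`. -/
def Us (k : ℕ) (s : Fin k → Bool) : Finset (Fin k → Fin 6) :=
  Finset.univ.filter fun u => ∀ i, u i ∈ typeSet (s i)

/-- `λ_k(u) ∈ 𝔽₂`: the parity of `#{i : u i ∈ {2,4}}`. -/
def lamK {k : ℕ} (u : Fin k → Fin 6) : ZMod 2 :=
  ((Finset.univ.filter fun i => u i = 2 ∨ u i = 4).card : ZMod 2)

/-- `c(u,v) ∈ 𝔽₂`: the parity of `#{i : u i, v i ∈ {0,2,4} and u i ≠ v i}`. -/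
def cPair {k : ℕ} (u v : Fin k → Fin 6) : ZMod 2 :=
  ((Finset.univ.filter fun i =>
      (u i = 0 ∨ u i = 2 ∨ u i = 4) ∧ (v i = 0 ∨ v i = 2 ∨ v i = 4) ∧ u i ≠ v i).card :
    ZMod 2)

lemma cPair_symm {k : ℕ} (u v : Fin k → Fin 6) : cPair u v = cPair v u := by
  unfold cPair
  congr 1
  congr 1
  apply Finset.filter_congr
  intro i _
  constructor
  · rintro ⟨h1, h2, h3⟩; exact ⟨h2, h1, h3.symm⟩
  · rintro ⟨h1, h2, h3⟩; exact ⟨h2, h1, h3.symm⟩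

/-- The sum `Σ_{{u,v} ⊆ U_s, u ≠ v} c(u,v)·x(u)·x(v) ∈ 𝔽₂` over unordered pairs of
distinct elements of `U_s`. -/
def pairSum (k : ℕ) (s : Fin k → Bool) (x : {u // u ∈ Us k s} → ZMod 2) : ZMod 2 :=
  ∑ p ∈ (Us k s).attach.sym2.filter fun p => ¬p.IsDiag,
    Sym2.lift
      ⟨fun u v => cPair u.1 v.1 * x u * x v, by
        intro u v
        show cPair u.1 v.1 * x u * x v = cPair v.1 u.1 * x v * x u
        rw [cPair_symm]
        ring⟩
      p

/-- `e(x) = Σ_{u ∈ U_s} λ_k(u)·x(u) + Σ_{{u,v} ⊆ U_s, u ≠ v} c(u,v)·x(u)·x(v) ∈ 𝔽₂`. -/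
def eFun (k : ℕ) (s : Fin k → Bool) (x : {u // u ∈ Us k s} → ZMod 2) : ZMod 2 :=
  (∑ u ∈ (Us k s).attach, lamK u.1 * x u) + pairSum k s x

/-- `x : U_s → 𝔽₂` is admissible if for every `i` the sum of `x` over
`{u ∈ U_s : u i ∈ {0,3}}` is `1` and the sums over `{u : u i ∈ {2,5}}` and
`{u : u i ∈ {1,4}}` are `0`. -/
def Admissible (k : ℕ) (s : Fin k → Bool) (x : {u // u ∈ Us k s} → ZMod 2) : Prop :=
  ∀ i : Fin k,
    (∑ u ∈ (Us k s).attach.filter fun u => u.1 i = 0 ∨ u.1 i = 3, x u) = 1 ∧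
      (∑ u ∈ (Us k s).attach.filter fun u => u.1 i = 2 ∨ u.1 i = 5, x u) = 0 ∧
      (∑ u ∈ (Us k s).attach.filter fun u => u.1 i = 1 ∨ u.1 i = 4, x u) = 0

/-- `γ(U_s) = Σ_{x admissible} σ(x)` where `σ(x) = 1` if `e(x) = 0` and `-1` otherwise. -/
def gammaU (k : ℕ) (s : Fin k → Bool) : ℤ :=
  ∑ x ∈ Finset.univ.filter fun x : {u // u ∈ Us k s} → ZMod 2 => Admissible k s x,
    if eFun k s x = 0 then (1 : ℤ) else -1

/-- The contribution to `cPair` of a single coordinate. -/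
def coordPair (a b : Fin 6) : ZMod 2 :=
  if (a = 0 ∨ a = 2 ∨ a = 4) ∧ (b = 0 ∨ b = 2 ∨ b = 4) ∧ a ≠ b then 1 else 0

/-- The sum of `x` over the points of `t` where `g` takes the value `b`. -/
def fibreSum {α : Type*} (x : α → ZMod 2) (g : α → Fin 6) (b : Fin 6) (t : Finset α) : ZMod 2 :=
  ∑ u ∈ t, if g u = b then x u else 0

/-- The second elementary symmetric function of the fibre sums over `0, 2, 4`. -/
def fibreSymm {α : Type*} (x : α → ZMod 2) (g : α → Fin 6) (t : Finset α) : ZMod 2 :=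
  fibreSum x g 0 t * fibreSum x g 2 t + fibreSum x g 0 t * fibreSum x g 4 t +
    fibreSum x g 2 t * fibreSum x g 4 t

lemma cPair_eq_sum {k : ℕ} (u v : Fin k → Fin 6) :
    cPair u v = ∑ i, coordPair (u i) (v i) := by
  simp [cPair, coordPair, Finset.sum_boole]

lemma lamK_eq_sum {k : ℕ} (u : Fin k → Fin 6) :
    lamK u = ∑ i, ((if u i = 2 then 1 else 0) + if u i = 4 then 1 else 0) := by
  rw [lamK, ← Finset.sum_boole]
  refine Finset.sum_congr rfl fun i _ => ?_
  generalize u i = a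
  fin_cases a <;> simp

lemma sum_coordPair_mul {α : Type*} (x : α → ZMod 2) (g : α → Fin 6) (a : Fin 6)
    (t : Finset α) :
    ∑ v ∈ t, coordPair a (g v) * x v =
      coordPair a 0 * fibreSum x g 0 t + coordPair a 2 * fibreSum x g 2 t +
        coordPair a 4 * fibreSum x g 4 t := by
  simp only [fibreSum, Finset.mul_sum, ← Finset.sum_add_distrib]
  refine Finset.sum_congr rfl fun v _ => ?_
  generalize g v = b
  fin_cases b <;> simp [coordPair]

lemma fibreSymm_insert {α : Type*} [DecidableEq α] (x : α → ZMod 2) (g : α → Fin 6) {a : α}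
    {t : Finset α} (ha : a ∉ t) :
    fibreSymm x g (insert a t) =
      (∑ v ∈ t, coordPair (g a) (g v) * x v) * x a + fibreSymm x g t := by
  rw [sum_coordPair_mul]
  simp only [fibreSymm, fibreSum, Finset.sum_insert ha]
  generalize g a = b
  fin_cases b <;> simp [coordPair] <;> ring

lemma sum_sym2_insert_filter_not_isDiag {α M : Type*} [DecidableEq α] [AddCommMonoid M]
    (F : Sym2 α → M) {a : α} {t : Finset α} (ha : a ∉ t) :
    ∑ p ∈ (insert a t).sym2.filter (fun p => ¬p.IsDiag), F p =
      ∑ v ∈ t, F s(a, v) + ∑ p ∈ t.sym2.filter (fun p => ¬p.IsDiag), F p := by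
  have h : (insert a t).sym2.filter (fun p => ¬p.IsDiag) =
      t.image (fun v => s(a, v)) ∪ t.sym2.filter (fun p => ¬p.IsDiag) := by
    ext p
    induction p with
    | _ u v =>
      simp only [Finset.mem_filter, Finset.mk_mem_sym2_iff, Finset.mem_insert, Sym2.mk_isDiag_iff,
        Finset.mem_union, Finset.mem_image, Sym2.eq_iff]
      grind
  rw [h, Finset.sum_union, Finset.sum_image]
  · intro u _ v _ huv
    grind [Sym2.eq_iff]
  · rw [Finset.disjoint_left]
    intro p hp hq
    obtain ⟨v, _, rfl⟩ := Finset.mem_image.1 hp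
    exact ha (Finset.mk_mem_sym2_iff.1 (Finset.mem_filter.1 hq).1).1

lemma sum_sym2_coordPair {α ι : Type*} [DecidableEq α] [Fintype ι] (x : α → ZMod 2)
    (g : ι → α → Fin 6) (F : Sym2 α → ZMod 2)
    (hF : ∀ u v, F s(u, v) = (∑ i, coordPair (g i u) (g i v)) * x u * x v) (t : Finset α) :
    ∑ p ∈ t.sym2.filter (fun p => ¬p.IsDiag), F p = ∑ i, fibreSymm x (g i) t := by
  induction t using Finset.induction_on with
  | empty => simp [fibreSymm, fibreSum]
  | insert a t ha ih =>
    rw [sum_sym2_insert_filter_not_isDiag F ha, ih]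
    simp only [fibreSymm_insert x _ ha, Finset.sum_add_distrib, hF]
    congr 1
    simp only [Finset.sum_mul]
    rw [Finset.sum_comm]
    exact Finset.sum_congr rfl fun i _ => Finset.sum_congr rfl fun v _ => by ring

lemma pairSum_eq_sum_fibreSymm {k : ℕ} (s : Fin k → Bool) (x : {u // u ∈ Us k s} → ZMod 2) :
    pairSum k s x = ∑ i, fibreSymm x (fun u => u.1 i) (Us k s).attach := by
  unfold pairSum
  refine sum_sym2_coordPair x (fun i u => u.1 i) _ (fun u v => ?_) _
  simp only [Sym2.lift_mk, cPair_eq_sum]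

lemma eFun_eq_sum {k : ℕ} (s : Fin k → Bool) (x : {u // u ∈ Us k s} → ZMod 2) :
    eFun k s x = ∑ i, (fibreSum x (fun u => u.1 i) 2 (Us k s).attach +
      fibreSum x (fun u => u.1 i) 4 (Us k s).attach +
      fibreSymm x (fun u => u.1 i) (Us k s).attach) := by
  rw [eFun, pairSum_eq_sum_fibreSymm, Finset.sum_add_distrib]
  congr 1
  simp only [lamK_eq_sum, Finset.sum_mul, fibreSum, ← Finset.sum_add_distrib]
  rw [Finset.sum_comm]
  simp only [add_mul, ite_mul, one_mul, zero_mul]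

lemma mem_typeSet {k : ℕ} {s : Fin k → Bool} (u : {u // u ∈ Us k s}) (i : Fin k) :
    u.1 i ∈ typeSet (s i) :=
  (Finset.mem_filter.1 u.2).2 i

lemma fibreSum_eq_zero_of_pair {k : ℕ} {s : Fin k → Bool} {x : {u // u ∈ Us k s} → ZMod 2}
    {i : Fin k} {b c : Fin 6} (hb : b ∈ typeSet true) (hc : c ∈ typeSet false)
    (h : ∑ u ∈ (Us k s).attach.filter (fun u => u.1 i = b ∨ u.1 i = c), x u = 0) :
    fibreSum x (fun u => u.1 i) b (Us k s).attach = 0 := by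
  have hne : ∀ a, a ∈ typeSet true → a ∈ typeSet false → False := by
    intro a; fin_cases a <;> simp [typeSet]
  cases hs : s i with
  | false =>
    refine Finset.sum_eq_zero fun u _ => if_neg fun (hu : u.1 i = b) => ?_
    have := mem_typeSet u i
    rw [hs, hu] at this
    exact hne b hb this
  | true =>
    rw [fibreSum, ← Finset.sum_filter, ← h]
    refine Finset.sum_congr (Finset.filter_congr fun u _ => ?_) fun _ _ => rfl
    refine ⟨Or.inl, fun hu => hu.resolve_right fun hu => ?_⟩
    have := mem_typeSet u i
    rw [hs, hu] at this
    exact hne c this hc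

lemma eFun_eq_zero_of_admissible {k : ℕ} {s : Fin k → Bool} {x : {u // u ∈ Us k s} → ZMod 2}
    (h : Admissible k s x) : eFun k s x = 0 := by
  rw [eFun_eq_sum]
  refine Finset.sum_eq_zero fun i _ => ?_
  have h2 : fibreSum x (fun u => u.1 i) 2 (Us k s).attach = 0 :=
    fibreSum_eq_zero_of_pair (by simp [typeSet]) (by simp [typeSet]) (h i).2.1
  have h4 : fibreSum x (fun u => u.1 i) 4 (Us k s).attach = 0 :=
    fibreSum_eq_zero_of_pair (c := 1) (by simp [typeSet]) (by simp [typeSet]) <| by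
      simpa only [or_comm] using (h i).2.2
  simp [fibreSymm, h2, h4]

lemma gammaU_eq_card {k : ℕ} (s : Fin k → Bool) :
    gammaU k s = Fintype.card {x : {u // u ∈ Us k s} → ZMod 2 // Admissible k s x} := by
  rw [gammaU, Fintype.card_subtype, Finset.card_eq_sum_ones, Nat.cast_sum]
  refine Finset.sum_congr rfl fun x hx => ?_
  rw [if_pos (eFun_eq_zero_of_admissible (Finset.mem_filter.1 hx).2), Nat.cast_one]

/-- Reduction modulo `3`. -/
def modThree (a : Fin 6) : Fin 3 := ![0, 1, 2, 0, 1, 2] a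

/-- The element of `typeSet b` with a given residue modulo `3`. -/
def typeSetRep (b : Bool) (j : Fin 3) : Fin 6 := if b then ![0, 4, 2] j else ![3, 1, 5] j

lemma typeSetRep_mem (b : Bool) (j : Fin 3) : typeSetRep b j ∈ typeSet b := by
  cases b <;> fin_cases j <;> simp [typeSetRep, typeSet]

lemma modThree_typeSetRep (b : Bool) (j : Fin 3) : modThree (typeSetRep b j) = j := by
  cases b <;> fin_cases j <;> simp [typeSetRep, modThree]

lemma typeSetRep_modThree {b : Bool} {a : Fin 6} (h : a ∈ typeSet b) :
    typeSetRep b (modThree a) = a := by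
  cases b <;> fin_cases a <;> simp_all [typeSetRep, modThree, typeSet]

/-- Coordinatewise reduction modulo `3` identifies `Us k s` with `Fin k → Fin 3`. -/
def usEquiv {k : ℕ} (s : Fin k → Bool) : {u // u ∈ Us k s} ≃ (Fin k → Fin 3) where
  toFun u i := modThree (u.1 i)
  invFun w := ⟨fun i => typeSetRep (s i) (w i), by simp [Us, typeSetRep_mem]⟩
  left_inv u := Subtype.ext <| funext fun i => typeSetRep_modThree (mem_typeSet u i)
  right_inv w := funext fun i => modThree_typeSetRep (s i) (w i)

lemma Tk_comp_usEquiv_symm {k : ℕ} (s : Fin k → Bool) (x : {u // u ∈ Us k s} → ZMod 2)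
    (i : Fin k) (j : Fin 3) :
    Tk k (x ∘ (usEquiv s).symm) (i, j) =
      ∑ u ∈ (Us k s).attach.filter (fun u => modThree (u.1 i) = j), x u := by
  change ∑ w ∈ Finset.univ.filter (fun w : Fin k → Fin 3 => w i = j),
    x ((usEquiv s).symm w) = _
  rw [Finset.sum_filter, Finset.sum_filter, Finset.attach_eq_univ, ← (usEquiv s).sum_comp]
  refine Finset.sum_congr rfl fun u _ => ?_
  rw [Equiv.symm_apply_apply]
  rfl

lemma admissible_iff_Tk {k : ℕ} (s : Fin k → Bool) (x : {u // u ∈ Us k s} → ZMod 2) :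
    Admissible k s x ↔
      Tk k (x ∘ (usEquiv s).symm) = fun p => if p.2 = 0 then 1 else 0 := by
  have h0 : ∀ a : Fin 6, (a = 0 ∨ a = 3) ↔ modThree a = 0 := by
    intro a; fin_cases a <;> simp [modThree]
  have h1 : ∀ a : Fin 6, (a = 1 ∨ a = 4) ↔ modThree a = 1 := by
    intro a; fin_cases a <;> simp [modThree]
  have h2 : ∀ a : Fin 6, (a = 2 ∨ a = 5) ↔ modThree a = 2 := by
    intro a; fin_cases a <;> simp [modThree]
  simp only [Admissible, h0, h1, h2, ← Tk_comp_usEquiv_symm, funext_iff, Prod.forall,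
    Fin.forall_fin_succ]
  simp
  grind

lemma Tk_single_zero (k : ℕ) :
    Tk k (Pi.single 0 1) = fun p => if p.2 = 0 then 1 else 0 := by
  funext p
  change ∑ w ∈ Finset.univ.filter (fun w : Fin k → Fin 3 => w p.1 = p.2),
    (Pi.single 0 1 : (Fin k → Fin 3) → ZMod 2) w = _
  rw [Finset.sum_pi_single']
  simp [eq_comm]

/-- Every nonempty fibre of a linear map is a translate of its kernel. -/
def fibreEquivKer {R V W : Type*} [Ring R] [AddCommGroup V] [AddCommGroup W] [Module R V]
    [Module R W] (T : V →ₗ[R] W) (y : V) : {x // T x = T y} ≃ LinearMap.ker T :=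
  (Equiv.subRight y).subtypeEquiv fun x => by simp [sub_eq_zero]

lemma card_admissible {k : ℕ} (s : Fin k → Bool) :
    Fintype.card {x : {u // u ∈ Us k s} → ZMod 2 // Admissible k s x} =
      2 ^ Module.finrank (ZMod 2) (LinearMap.ker (Tk k)) := by
  let e : {x : {u // u ∈ Us k s} → ZMod 2 // Admissible k s x} ≃
      {y // Tk k y = Tk k (Pi.single 0 1)} :=
    ((usEquiv s).arrowCongr (Equiv.refl (ZMod 2))).subtypeEquiv fun x => by
      rw [Tk_single_zero, admissible_iff_Tk]
      rfl
  rw [Fintype.card_congr (e.trans (fibreEquivKer (Tk k) _)),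
    Module.card_eq_pow_finrank (K := ZMod 2), ZMod.card]

theorem sum_gamma_eq_kernel (k : ℕ) (hk : 1 ≤ k) :
    ∑ s : Fin k → Bool, gammaU k s =
      2 ^ (k + Module.finrank (ZMod 2) (LinearMap.ker (Tk k))) := by
  simp only [gammaU_eq_card, card_admissible, Finset.sum_const, Finset.card_univ, Fintype.card_fun,
    Fintype.card_bool, Fintype.card_fin]
  simp [pow_add]
end
end

section
/- For every integer k ≥ 1, Σ_{s ∈ {A,B}^k} γ(U_s) = 2^{3^k − k − 1}. -/
open Finset

open scoped Classical

noncomputable section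

/-- The residue classes `1` and `2` modulo `3`, indexed by `Bool`. -/
def nonzeroClass (c : Bool) : ℕ := if c then 2 else 1

/-- The element of `typeSet b` divisible by `3`. -/
def baseElt (b : Bool) : Fin 6 := if b then 0 else 3

/-- The element of `typeSet b` congruent to `nonzeroClass c` modulo `3`. -/
def classElt (b c : Bool) : Fin 6 :=
  if b then (if c then 2 else 4) else (if c then 5 else 1)

lemma baseElt_mem (b : Bool) : baseElt b ∈ typeSet b := by
  cases b <;> simp [baseElt, typeSet]

lemma classElt_mem (b c : Bool) : classElt b c ∈ typeSet b := by
  cases b <;> cases c <;> simp [classElt, typeSet]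

lemma baseElt_mod_ne (b c : Bool) : (baseElt b : ℕ) % 3 ≠ nonzeroClass c := by
  cases b <;> cases c <;> decide

lemma classElt_mod_eq_iff (b c d : Bool) :
    (classElt b c : ℕ) % 3 = nonzeroClass d ↔ c = d := by
  cases b <;> cases c <;> cases d <;> decide

lemma card_Us (k : ℕ) (s : Fin k → Bool) : (Us k s).card = 3 ^ k := by
  have h : Us k s = Fintype.piFinset fun i => typeSet (s i) := by
    ext u
    simp [Us]
  have h3 : ∀ b, (typeSet b).card = 3 := by
    intro b
    cases b <;> rfl
  simp [h, h3]

/-- The point of `U_s` all of whose coordinates are divisible by `3`. -/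
def basePoint {k : ℕ} (s : Fin k → Bool) : {u // u ∈ Us k s} :=
  ⟨fun i => baseElt (s i), by simp [Us, baseElt_mem]⟩

/-- The base point with its `i`-th coordinate moved to the class `nonzeroClass c`. -/
def classPoint {k : ℕ} (s : Fin k → Bool) (i : Fin k) (c : Bool) : {u // u ∈ Us k s} :=
  ⟨fun j => if j = i then classElt (s j) c else baseElt (s j), by
    simp only [Us, mem_filter, mem_univ, true_and]
    intro j
    split_ifs
    exacts [classElt_mem _ _, baseElt_mem _]⟩

/-- The coefficients of the independent linear forms defining admissibility. -/
def weight {k : ℕ} (s : Fin k → Bool) :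
    Matrix (Option (Fin k × Bool)) {u // u ∈ Us k s} (ZMod 2) := fun j u =>
  j.elim 1 fun p => if (u.1 p.1 : ℕ) % 3 = nonzeroClass p.2 then 1 else 0

lemma weight_basePoint {k : ℕ} (s : Fin k → Bool) :
    (fun j => weight s j (basePoint s)) = Pi.single none 1 := by
  ext j
  cases j with
  | none => simp [weight]
  | some p => simp [weight, basePoint, baseElt_mod_ne]

lemma weight_classPoint {k : ℕ} (s : Fin k → Bool) (i : Fin k) (c : Bool) :
    (fun j => weight s j (classPoint s i c)) = Pi.single none 1 + Pi.single (some (i, c)) 1 := by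
  ext j
  cases j with
  | none => simp [weight]
  | some p =>
    obtain ⟨i', c'⟩ := p
    by_cases h : i' = i
    · subst h
      simp [weight, classPoint, classElt_mod_eq_iff, Pi.single_apply, eq_comm (a := c')]
    · simp [weight, classPoint, h, baseElt_mod_ne]

lemma range_mulVecLin_weight {k : ℕ} (s : Fin k → Bool) :
    (weight s).mulVecLin.range = ⊤ := by
  have hcol : ∀ u, (fun j => weight s j u) ∈ (weight s).mulVecLin.range := by
    intro u
    refine ⟨Pi.single u 1, ?_⟩
    ext j
    simp
  have hnone : Pi.single none 1 ∈ (weight s).mulVecLin.range :=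
    weight_basePoint s ▸ hcol (basePoint s)
  have hsome : ∀ i c, Pi.single (some (i, c)) 1 ∈ (weight s).mulVecLin.range := by
    intro i c
    have h := Submodule.sub_mem _ (weight_classPoint s i c ▸ hcol (classPoint s i c)) hnone
    rwa [add_sub_cancel_left] at h
  rw [eq_top_iff]
  intro y _
  rw [pi_eq_sum_univ' y]
  refine Submodule.sum_mem _ fun j _ => Submodule.smul_mem _ _ ?_
  rcases j with _ | ⟨i, c⟩
  exacts [hnone, hsome i c]

/-- A surjective additive map between finite groups has fibres of constant size. -/
lemma card_fiber_mul_card {G H : Type*} [AddGroup G] [AddGroup H] [Fintype G] [Fintype H]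
    (f : G →+ H) (hf : Function.Surjective f) (y : H) :
    (univ.filter fun x => f x = y).card * Fintype.card H = Fintype.card G := by
  have h := card_eq_sum_card_fiberwise (f := f) (s := univ) (t := univ) (by simp)
  rw [← card_univ (α := G), h, sum_congr rfl fun z _ =>
    AddMonoidHom.card_fiber_eq_of_mem_range f (hf z) (hf y)]
  simp [mul_comm]

lemma admissible_iff {k : ℕ} (hk : 1 ≤ k) (s : Fin k → Bool) (x : {u // u ∈ Us k s} → ZMod 2) :
    Admissible k s x ↔ (weight s).mulVecLin x = Pi.single none 1 := by
  have hmod : ∀ a : Fin 6, ((a = 0 ∨ a = 3) ↔ (a : ℕ) % 3 = 0) ∧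
      ((a = 2 ∨ a = 5) ↔ (a : ℕ) % 3 = 2) ∧ ((a = 1 ∨ a = 4) ↔ (a : ℕ) % 3 = 1) := by
    decide
  have htotal : ∀ i, (weight s).mulVecLin x none =
      (∑ u ∈ (Us k s).attach.filter fun u => u.1 i = 0 ∨ u.1 i = 3, x u) +
      (∑ u ∈ (Us k s).attach.filter fun u => u.1 i = 2 ∨ u.1 i = 5, x u) +
      ∑ u ∈ (Us k s).attach.filter fun u => u.1 i = 1 ∨ u.1 i = 4, x u := by
    intro i
    simp only [Matrix.mulVecLin_apply, Matrix.mulVec, dotProduct, sum_filter, ← sum_add_distrib,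
      univ_eq_attach]
    refine sum_congr rfl fun u _ => ?_
    generalize u.1 i = a
    fin_cases a <;> simp [weight]
  have htwo : ∀ i, (weight s).mulVecLin x (some (i, true)) =
      ∑ u ∈ (Us k s).attach.filter fun u => u.1 i = 2 ∨ u.1 i = 5, x u := by
    intro i
    simp [Matrix.mulVec, dotProduct, weight, nonzeroClass, sum_filter, hmod]
  have hone : ∀ i, (weight s).mulVecLin x (some (i, false)) =
      ∑ u ∈ (Us k s).attach.filter fun u => u.1 i = 1 ∨ u.1 i = 4, x u := by
    intro i
    simp [Matrix.mulVec, dotProduct, weight, nonzeroClass, sum_filter, hmod]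
  constructor
  · intro h
    ext j
    rcases j with _ | ⟨i, _ | _⟩
    · simp [htotal ⟨0, hk⟩, h ⟨0, hk⟩]
    · simp [hone, h i]
    · simp [htwo, h i]
  · intro h i
    have h0 := htotal i
    have h1 := hone i
    have h2 := htwo i
    simp only [h, Pi.single_eq_same, ne_eq, reduceCtorEq, not_false_eq_true,
      Pi.single_eq_of_ne] at h0 h1 h2
    rw [← h1, ← h2] at h0 ⊢
    simpa using h0.symm

lemma card_admissible_s15 {k : ℕ} (hk : 1 ≤ k) (s : Fin k → Bool) :
    (univ.filter fun x => Admissible k s x).card * 2 ^ (2 * k + 1) = 2 ^ 3 ^ k := by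
  have h := card_fiber_mul_card (weight s).mulVecLin.toAddMonoidHom
    (LinearMap.range_eq_top.1 (range_mulVecLin_weight s)) (Pi.single none 1)
  have hdim : Fintype.card (Option (Fin k × Bool) → ZMod 2) = 2 ^ (2 * k + 1) := by
    simp [mul_comm k 2]
  have hdom : Fintype.card ({u // u ∈ Us k s} → ZMod 2) = 2 ^ 3 ^ k := by
    simp [card_Us]
  rw [hdim, hdom] at h
  convert! h using 4
  exact admissible_iff hk s _

/-- Over unordered pairs of distinct points, the symmetrization of `f u * g v` sums to the product
of the sums when `f` and `g` have disjoint supports. -/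
lemma sum_sym2_symmetrization {α R : Type*} [CommSemiring R] (t : Finset α) (f g : α → R)
    (hfg : ∀ u, f u * g u = 0) :
    ∑ p ∈ t.sym2.filter fun p => ¬p.IsDiag,
      Sym2.lift ⟨fun u v => f u * g v + f v * g u, fun _ _ => add_comm _ _⟩ p =
      (∑ u ∈ t, f u) * ∑ u ∈ t, g u := by
  let _ : LinearOrder α := linearOrderOfSTO WellOrderingRel
  have hswap : ∑ q ∈ t.offDiag with q.1 < q.2, f q.2 * g q.1 =
      ∑ q ∈ t.offDiag with ¬q.1 < q.2, f q.1 * g q.2 := by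
    refine sum_equiv (Equiv.prodComm α α) (fun q => ?_) (fun _ _ => rfl)
    simp only [mem_filter, mem_offDiag, Equiv.prodComm_apply, Prod.fst_swap, Prod.snd_swap, not_lt]
    grind
  have hsum : ∑ q ∈ t.offDiag, f q.1 * g q.2 = ∑ q ∈ t ×ˢ t, f q.1 * g q.2 := by
    refine sum_subset (fun q hq => ?_) (fun q hq hq' => ?_)
    · rw [mem_offDiag] at hq
      exact mem_product.2 ⟨hq.1, hq.2.1⟩
    · rw [mem_product] at hq
      have h : q.1 = q.2 := by
        by_contra h
        exact hq' (mem_offDiag.2 ⟨hq.1, hq.2, h⟩)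
      rw [h, hfg]
  have h := sum_sym2_filter_not_isDiag t
    (Sym2.lift ⟨fun u v => f u * g v + f v * g u, fun _ _ => add_comm _ _⟩)
  simp only [Sym2.lift_mk, sum_add_distrib] at h
  rw [hswap, sum_filter_add_sum_filter_not, hsum, sum_product, ← sum_mul_sum] at h
  convert h

/-- The restriction of `x` to the points whose `i`-th coordinate is `a`. -/
def coordSlice {k : ℕ} {s : Fin k → Bool} (x : {u // u ∈ Us k s} → ZMod 2) (i : Fin k) (a : Fin 6)
    (u : {u // u ∈ Us k s}) : ZMod 2 :=
  if u.1 i = a then x u else 0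

lemma Admissible.sum_coordSlice_eq_zero {k : ℕ} {s : Fin k → Bool} {x : {u // u ∈ Us k s} → ZMod 2}
    (hx : Admissible k s x) (i : Fin k) {a : Fin 6} (ha : a = 2 ∨ a = 4) :
    ∑ u ∈ (Us k s).attach, coordSlice x i a u = 0 := by
  have hmem : ∀ u : {u // u ∈ Us k s}, u.1 i ∈ typeSet (s i) := fun u =>
    (mem_filter.1 u.2).2 i
  cases hs : s i with
  | false =>
    refine sum_eq_zero fun u _ => if_neg ?_
    have h := hmem u
    rw [hs] at h
    intro h'
    rw [h'] at h
    rcases ha with rfl | rfl <;> simp [typeSet] at h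
  | true =>
    have hB : ∀ u : {u // u ∈ Us k s}, u.1 i ≠ 5 ∧ u.1 i ≠ 1 := by
      intro u
      have h := hmem u
      rw [hs] at h
      constructor <;> intro h' <;> rw [h'] at h <;> simp [typeSet] at h
    obtain ⟨-, h2, h4⟩ := hx i
    rcases ha with rfl | rfl
    · simpa [sum_filter, hB, coordSlice] using h2
    · simpa [sum_filter, hB, coordSlice] using h4

lemma Admissible.sum_lamK_eq_zero {k : ℕ} {s : Fin k → Bool} {x : {u // u ∈ Us k s} → ZMod 2}
    (hx : Admissible k s x) : ∑ u ∈ (Us k s).attach, lamK u.1 * x u = 0 := by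
  have h : ∀ u : {u // u ∈ Us k s}, lamK u.1 * x u = ∑ i, (coordSlice x i 2 u + coordSlice x i 4 u) := by
    intro u
    simp only [lamK, card_filter, Nat.cast_sum, sum_mul]
    refine sum_congr rfl fun i _ => ?_
    unfold coordSlice
    generalize u.1 i = a
    fin_cases a <;> simp
  simp only [h]
  rw [sum_comm]
  refine sum_eq_zero fun i _ => ?_
  rw [sum_add_distrib, hx.sum_coordSlice_eq_zero i (.inl rfl), hx.sum_coordSlice_eq_zero i (.inr rfl),
    add_zero]

lemma cPair_mul_mul {k : ℕ} {s : Fin k → Bool} (x : {u // u ∈ Us k s} → ZMod 2)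
    (u v : {u // u ∈ Us k s}) :
    cPair u.1 v.1 * x u * x v = ∑ i,
      ((coordSlice x i 0 u * coordSlice x i 2 v + coordSlice x i 0 v * coordSlice x i 2 u) +
        (coordSlice x i 0 u * coordSlice x i 4 v + coordSlice x i 0 v * coordSlice x i 4 u) +
        (coordSlice x i 2 u * coordSlice x i 4 v + coordSlice x i 2 v * coordSlice x i 4 u)) := by
  simp only [cPair, card_filter, Nat.cast_sum, sum_mul]
  refine sum_congr rfl fun i _ => ?_
  unfold coordSlice
  generalize u.1 i = a
  generalize v.1 i = b
  fin_cases a <;> fin_cases b <;> simp [mul_comm]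

lemma coordSlice_mul_coordSlice {k : ℕ} {s : Fin k → Bool} (x : {u // u ∈ Us k s} → ZMod 2) (i : Fin k)
    {a b : Fin 6} (hab : a ≠ b) (u : {u // u ∈ Us k s}) : coordSlice x i a u * coordSlice x i b u = 0 := by
  unfold coordSlice
  split_ifs with ha hb
  · exact absurd (ha.symm.trans hb) hab
  all_goals simp

lemma Admissible.pairSum_eq_zero {k : ℕ} {s : Fin k → Bool} {x : {u // u ∈ Us k s} → ZMod 2}
    (hx : Admissible k s x) : pairSum k s x = 0 := by
  have h : pairSum k s x = ∑ i,
      ((∑ u ∈ (Us k s).attach, coordSlice x i 0 u) * (∑ u ∈ (Us k s).attach, coordSlice x i 2 u) +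
        (∑ u ∈ (Us k s).attach, coordSlice x i 0 u) * (∑ u ∈ (Us k s).attach, coordSlice x i 4 u) +
        (∑ u ∈ (Us k s).attach, coordSlice x i 2 u) * ∑ u ∈ (Us k s).attach, coordSlice x i 4 u) := by
    simp only [← sum_sym2_symmetrization _ _ _ (coordSlice_mul_coordSlice x _ (by decide : (0 : Fin 6) ≠ 2)),
      ← sum_sym2_symmetrization _ _ _ (coordSlice_mul_coordSlice x _ (by decide : (0 : Fin 6) ≠ 4)),
      ← sum_sym2_symmetrization _ _ _ (coordSlice_mul_coordSlice x _ (by decide : (2 : Fin 6) ≠ 4)),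
      ← sum_add_distrib]
    rw [sum_comm, pairSum]
    refine sum_congr (by congr!) fun p _ => ?_
    induction p with
    | h u v => exact cPair_mul_mul x u v
  simp [h, hx.sum_coordSlice_eq_zero]

lemma gammaU_eq_card_admissible (k : ℕ) (s : Fin k → Bool) :
    gammaU k s = (univ.filter fun x => Admissible k s x).card := by
  have h : ∀ x ∈ univ.filter fun x => Admissible k s x,
      (if eFun k s x = 0 then (1 : ℤ) else -1) = 1 := by
    intro x hx
    have hx := (mem_filter.1 hx).2
    simp [eFun, hx.sum_lamK_eq_zero, hx.pairSum_eq_zero]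
  simp [gammaU, sum_congr rfl h]

theorem sum_gamma_eq (k : ℕ) (hk : 1 ≤ k) :
    ∑ s : Fin k → Bool, gammaU k s = 2 ^ (3 ^ k - k - 1) := by
  have hlt : k < 3 ^ k := Nat.lt_pow_self (by norm_num)
  refine mul_right_cancel₀ (b := (2 : ℤ) ^ (k + 1)) (by positivity) ?_
  rw [← pow_add, show 3 ^ k - k - 1 + (k + 1) = 3 ^ k by omega]
  refine mul_right_cancel₀ (b := (2 : ℤ) ^ k) (by positivity) ?_
  rw [mul_assoc, ← pow_add, show k + 1 + k = 2 * k + 1 by omega, sum_mul]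
  have h : ∀ s : Fin k → Bool, gammaU k s * 2 ^ (2 * k + 1) = 2 ^ 3 ^ k := by
    intro s
    rw [gammaU_eq_card_admissible]
    exact_mod_cast card_admissible_s15 hk s
  simp only [h, sum_const, card_univ, Fintype.card_fun, Fintype.card_bool, Fintype.card_fin]
  simp [mul_comm]
end
end
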